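/- arXiv:2211.00180 — 4 statements merged into one kernel-verified Lean document; each statement's English description precedes it below -/
import Mathlib

section
/- Fix an integer k ≥ 0, an integer α ≥ 0, and a real Y > 0, and let r_* = (√(Y²+4) − Y)/2. Then lim_{N→∞} √(2πN) · Y^{α+1/2} · (Y²+4)^{1/4} · r_*^{2(N−k)+α+1} · e^{−NY·r_*} · L_{N−k}^{(α)}(−NY²) = 1. -/
/-- The generalized Laguerre polynomial
`L_n^{(α)}(x) = Σ_{k=0}^n (−1)^k · binom(n+α, n−k) · x^k/k!`. -/
noncomputable def Lag (n α : ℕ) (x : ℝ) : ℝ :=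
  ∑ k ∈ Finset.range (n + 1),
    (-1 : ℝ) ^ k * ((n + α).choose (n - k) : ℝ) * x ^ k / (Nat.factorial k : ℝ)

/-- `r_*(Y) = (√(Y²+4) − Y)/2`. -/
noncomputable def rstar (Y : ℝ) : ℝ := (Real.sqrt (Y ^ 2 + 4) - Y) / 2

lemma aux_expSeries (z : ℂ) : HasSum (fun j : ℕ => z ^ j / (Nat.factorial j : ℂ)) (Complex.exp z) := by
  rw [Complex.exp_eq_exp_ℂ]
  exact NormedSpace.expSeries_div_hasSum_exp z

/-- Double series expansion of the generating function. -/
lemma aux_inner (α : ℕ) (x : ℂ) (t : ℂ) (ht : ‖t‖ < 1) (j : ℕ) :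
    HasSum (fun i : ℕ => x ^ j / (Nat.factorial j : ℂ) *
      ((i + (α + j)).choose (α + j) : ℂ) * t ^ (j + i))
      ((x * (t / (1 - t))) ^ j / (Nat.factorial j : ℂ) * (1 / (1 - t) ^ (α + 1))) := by
  have h := (hasSum_choose_mul_geometric_of_norm_lt_one (α + j) ht).mul_left
    (x ^ j / (Nat.factorial j : ℂ) * t ^ j)
  have h1 : (1 - t) ≠ 0 := by
    intro h0
    have : t = 1 := by linear_combination -h0
    rw [this] at ht; simp at ht
  convert h using 1
  · rfl
  · funext i; rw [pow_add]; ring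
  · rw [mul_pow, div_pow, pow_add, pow_add, pow_add]
    field_simp

lemma aux_summable (α : ℕ) (x ρ : ℝ) (hx : 0 ≤ x) (h0 : 0 ≤ ρ) (h1 : ρ < 1) :
    Summable (fun p : ℕ × ℕ => x ^ p.1 / (Nat.factorial p.1 : ℝ) *
      ((p.2 + (α + p.1)).choose (α + p.1) : ℝ) * ρ ^ (p.1 + p.2)) := by
  have hn : ‖(ρ : ℂ)‖ < 1 := by simpa [abs_of_nonneg h0] using h1
  have key : ∀ j : ℕ, HasSum (fun i : ℕ => x ^ j / (Nat.factorial j : ℝ) *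
      ((i + (α + j)).choose (α + j) : ℝ) * ρ ^ (j + i))
      ((x * (ρ / (1 - ρ))) ^ j / (Nat.factorial j : ℝ) * (1 / (1 - ρ) ^ (α + 1))) := by
    intro j
    have := aux_inner α (x : ℂ) (ρ : ℂ) hn j
    exact_mod_cast this
  rw [summable_prod_of_nonneg]
  · refine ⟨fun j => (key j).summable, ?_⟩
    have : (fun j : ℕ => ∑' i : ℕ, x ^ j / (Nat.factorial j : ℝ) *
      ((i + (α + j)).choose (α + j) : ℝ) * ρ ^ (j + i)) = fun j =>
      ((x * (ρ / (1 - ρ))) ^ j / (Nat.factorial j : ℝ) * (1 / (1 - ρ) ^ (α + 1))) :=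
      funext fun j => (key j).tsum_eq
    simp only [this]
    exact (Real.summable_pow_div_factorial _).mul_right _
  · intro p
    simp only [Pi.zero_apply]
    positivity

lemma aux_hasSum (α : ℕ) (x : ℝ) (hx : 0 ≤ x) (t : ℂ) (ht : ‖t‖ < 1) :
    HasSum (fun p : ℕ × ℕ => (x : ℂ) ^ p.1 / (Nat.factorial p.1 : ℂ) *
      ((p.2 + (α + p.1)).choose (α + p.1) : ℂ) * t ^ (p.1 + p.2))
      (Complex.exp (x * (t / (1 - t))) * (1 / (1 - t) ^ (α + 1))) := by
  have hs : Summable (fun p : ℕ × ℕ => (x : ℂ) ^ p.1 / (Nat.factorial p.1 : ℂ) *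
      ((p.2 + (α + p.1)).choose (α + p.1) : ℂ) * t ^ (p.1 + p.2)) := by
    apply Summable.of_norm
    convert aux_summable α x ‖t‖ hx (norm_nonneg _) ht using 2 with p
    simp [abs_of_nonneg hx]
  have h2 := hs.hasSum.prod_fiberwise (fun j => aux_inner α (x : ℂ) t ht j)
  have h3 := (aux_expSeries ((x : ℂ) * (t / (1 - t)))).mul_right (1 / (1 - t) ^ (α + 1))
  rw [← h2.unique h3]
  exact hs.hasSum

lemma aux_fourier (m n : ℕ) : ∫ θ in (-Real.pi)..Real.pi,
    Complex.exp (θ * Complex.I) ^ m * Complex.exp (-(n * θ * Complex.I)) =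
      if m = n then 2 * (Real.pi : ℂ) else 0 := by
  have e : ∀ θ : ℝ, Complex.exp (θ * Complex.I) ^ m * Complex.exp (-(n * θ * Complex.I)) =
      Complex.exp ((((m : ℂ) - n) * Complex.I) * θ) := by
    intro θ
    rw [← Complex.exp_nat_mul, ← Complex.exp_add]; congr 1; ring
  simp only [e]
  split_ifs with h
  · subst h
    simp; ring
  · have hc : (((m : ℂ) - n) * Complex.I) ≠ 0 := by
      apply mul_ne_zero _ Complex.I_ne_zero
      rw [sub_ne_zero]; exact_mod_cast h
    rw [integral_exp_mul_complex hc]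
    have : Complex.exp ((((m : ℂ) - n) * Complex.I) * (Real.pi : ℝ)) =
        Complex.exp ((((m : ℂ) - n) * Complex.I) * ((-Real.pi : ℝ) : ℂ)) := by
      rw [Complex.exp_eq_exp_iff_exists_int]
      refine ⟨(m : ℤ) - n, ?_⟩
      push_cast; ring
    rw [this]; simp

lemma aux_coeff (n α : ℕ) (x ρ : ℝ) (hx : 0 ≤ x) (h0 : 0 ≤ ρ) (h1 : ρ < 1) :
    ∫ θ in (-Real.pi)..Real.pi,
      (Complex.exp (x * ((ρ * Complex.exp (θ * Complex.I)) / (1 - ρ * Complex.exp (θ * Complex.I)))) *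
        (1 / (1 - ρ * Complex.exp (θ * Complex.I)) ^ (α + 1))) * Complex.exp (-(n * θ * Complex.I))
      = ((2 * Real.pi * ρ ^ n * Lag n α (-x) : ℝ) : ℂ) := by
  have hnorm : ∀ θ : ℝ, ‖(ρ : ℂ) * Complex.exp (θ * Complex.I)‖ = ρ := by
    intro θ; rw [norm_mul, Complex.norm_exp_ofReal_mul_I]; simp [abs_of_nonneg h0]
  let F : ℕ × ℕ → C(ℝ, ℂ) := fun p => ⟨fun θ => ((x : ℂ) ^ p.1 / (Nat.factorial p.1 : ℂ) *
      ((p.2 + (α + p.1)).choose (α + p.1) : ℂ) * (ρ * Complex.exp (θ * Complex.I)) ^ (p.1 + p.2)) *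
      Complex.exp (-(n * θ * Complex.I)), by fun_prop⟩
  have hF : ∀ p : ℕ × ℕ, ∫ θ in (-Real.pi)..Real.pi, F p θ =
      ((x : ℂ) ^ p.1 / (Nat.factorial p.1 : ℂ) *
      ((p.2 + (α + p.1)).choose (α + p.1) : ℂ) * ρ ^ (p.1 + p.2)) *
        (if p.1 + p.2 = n then 2 * (Real.pi : ℂ) else 0) := by
    intro p
    rw [← aux_fourier, ← intervalIntegral.integral_const_mul]
    congr 1; funext θ
    simp only [F, ContinuousMap.coe_mk, mul_pow]; ring
  have hS := intervalIntegral.hasSum_intervalIntegral_of_summable_norm (a := -Real.pi) (b := Real.pi) (f := F) ?_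
  · have hfin := hasSum_sum_of_ne_finset_zero (L := SummationFilter.unconditional _) (s := Finset.HasAntidiagonal.antidiagonal n)
      (f := fun p => ∫ θ in (-Real.pi)..Real.pi, F p θ) ?_
    · have heq := hS.unique hfin
      have hlhs : ∀ θ : ℝ, ∑' p, F p θ =
        (Complex.exp (x * ((ρ * Complex.exp (θ * Complex.I)) / (1 - ρ * Complex.exp (θ * Complex.I)))) *
        (1 / (1 - ρ * Complex.exp (θ * Complex.I)) ^ (α + 1))) * Complex.exp (-(n * θ * Complex.I)) := by
        intro θ
        exact ((aux_hasSum α x hx _ (by rw [hnorm]; exact h1)).mul_right _).tsum_eq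
      simp only [hlhs] at heq
      rw [heq]
      simp only [hF]
      rw [Finset.Nat.sum_antidiagonal_eq_sum_range_succ_mk]
      simp only [Lag]
      rw [Finset.mul_sum]
      push_cast
      refine Finset.sum_congr rfl fun j hj => ?_
      have hj' : j ≤ n := by simpa [Nat.lt_succ_iff] using hj
      have e1 : j + (n - j) = n := by omega
      have e2 : n - j + (α + j) = n + α := by omega
      have e3 : (n + α).choose (α + j) = (n + α).choose (n - j) := by
        rw [← Nat.choose_symm (by omega)]; congr 1; omega
      rw [e1, e2, e3, if_pos rfl, neg_pow (x : ℂ)]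
      have : ((-1 : ℂ) ^ j * (-1) ^ j) = 1 := by rw [← mul_pow]; simp
      linear_combination (-(2 * Real.pi * ρ ^ n * ((n + α).choose (n - j)) * x ^ j / (Nat.factorial j : ℂ))) * this
    · intro p hp
      rw [hF, if_neg (by simpa using hp), mul_zero]
  · refine Summable.of_nonneg_of_le (fun _ => norm_nonneg _) (fun p => ?_) (aux_summable α x ρ hx h0 h1)
    rw [ContinuousMap.norm_le _ (by positivity)]
    rintro ⟨θ, hθ⟩
    simp only [F, ContinuousMap.restrict_apply, ContinuousMap.coe_mk]
    have : ‖Complex.exp (-(n * θ * Complex.I))‖ = 1 := by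
      have := Complex.norm_exp_ofReal_mul_I (-(n * θ))
      push_cast at this
      rw [← this]; congr 2; ring
    rw [norm_mul, this, norm_mul, norm_pow, hnorm]
    simp [abs_of_nonneg hx]

/-- The normalized integrand. -/
noncomputable def auxH (k α : ℕ) (A ρ : ℝ) (N : ℕ) (θ : ℝ) : ℂ :=
  Complex.exp (N * (A * (ρ * Complex.exp (θ * Complex.I) / (1 - ρ * Complex.exp (θ * Complex.I))
    - ρ / (1 - ρ)))) * (1 / (1 - ρ * Complex.exp (θ * Complex.I)) ^ (α + 1)) *
    Complex.exp (-((N - k) * θ * Complex.I))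

lemma aux_sqrt_inv : Filter.Tendsto (fun N : ℕ => (1 / Real.sqrt N : ℝ)) Filter.atTop (nhds 0) := by
  simp only [one_div]
  exact (Real.tendsto_sqrt_atTop.comp tendsto_natCast_atTop_atTop).inv_tendsto_atTop

lemma aux_B2 (u : ℝ) : Filter.Tendsto (fun N : ℕ => (N : ℂ) *
    (Complex.exp (((u / Real.sqrt N : ℝ) : ℂ) * Complex.I) - 1 - ((u / Real.sqrt N : ℝ) : ℂ) * Complex.I))
    Filter.atTop (nhds (-(u : ℂ) ^ 2 / 2)) := by
  rw [tendsto_iff_norm_sub_tendsto_zero]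
  have hz : Filter.Tendsto (fun N : ℕ => |u| ^ 3 * (1 / Real.sqrt N : ℝ)) Filter.atTop (nhds 0) := by
    simpa using aux_sqrt_inv.const_mul (|u| ^ 3)
  have hsm : ∀ᶠ N : ℕ in Filter.atTop, |u| * (1 / Real.sqrt N : ℝ) < 1 := by
    have : Filter.Tendsto (fun N : ℕ => |u| * (1 / Real.sqrt N : ℝ)) Filter.atTop (nhds 0) := by
      simpa using aux_sqrt_inv.const_mul (|u|)
    exact this.eventually (gt_mem_nhds one_pos)
  refine squeeze_zero' (Filter.Eventually.of_forall fun _ => norm_nonneg _) ?_ hz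
  filter_upwards [hsm, Filter.eventually_ge_atTop 1] with N h1 hN
  have hN0 : (0 : ℝ) < N := by exact_mod_cast hN
  have hs : 0 < Real.sqrt N := Real.sqrt_pos.2 hN0
  have hss : Real.sqrt N ^ 2 = N := Real.sq_sqrt hN0.le
  set z : ℂ := ((u / Real.sqrt N : ℝ) : ℂ) * Complex.I with hzdef
  have hzn : ‖z‖ = |u| / Real.sqrt N := by
    rw [hzdef, norm_mul, Complex.norm_I, mul_one, Complex.norm_real, Real.norm_eq_abs, abs_div,
      abs_of_pos hs]
  have hz1 : ‖z‖ ≤ 1 := by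
    rw [hzn]; rw [mul_one_div] at h1; exact h1.le
  have hb := Complex.exp_bound hz1 (n := 3) (by norm_num)
  have hzz : (N : ℂ) * z ^ 2 = -(u : ℂ) ^ 2 := by
    rw [hzdef, mul_pow, Complex.I_sq]
    have : (N : ℝ) * (u / Real.sqrt N) ^ 2 = u ^ 2 := by
      rw [div_pow, hss]; field_simp
    have h2 : (N : ℂ) * ((u / Real.sqrt N : ℝ) : ℂ) ^ 2 = (u : ℂ) ^ 2 := by exact_mod_cast this
    linear_combination -h2
  have e : (N : ℂ) * (Complex.exp z - 1 - z) - -(u : ℂ) ^ 2 / 2 =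
      N * (Complex.exp z - ∑ m ∈ Finset.range 3, z ^ m / (m.factorial : ℂ)) := by
    simp only [Finset.sum_range_succ, Finset.sum_range_zero, Nat.factorial]
    push_cast
    linear_combination (1 / 2 : ℂ) * hzz
  rw [e, norm_mul, Complex.norm_natCast]
  have hb' : ‖Complex.exp z - ∑ m ∈ Finset.range 3, z ^ m / (m.factorial : ℂ)‖ ≤ ‖z‖ ^ 3 := by
    refine hb.trans ?_
    have : (0 : ℝ) ≤ ‖z‖ ^ 3 := by positivity
    norm_num [Nat.factorial]
    nlinarith
  calc (N : ℝ) * _ ≤ N * ‖z‖ ^ 3 := by gcongr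
    _ = |u| ^ 3 * (1 / Real.sqrt N) := by
      rw [hzn, ← hss]
      have : Real.sqrt (Real.sqrt N ^ 2) = Real.sqrt N := by rw [hss]
      rw [this]
      field_simp

lemma aux_B1 (u : ℝ) : Filter.Tendsto (fun N : ℕ => ((Real.sqrt N : ℝ) : ℂ) *
    (Complex.exp (((u / Real.sqrt N : ℝ) : ℂ) * Complex.I) - 1))
    Filter.atTop (nhds ((u : ℂ) * Complex.I)) := by
  have h1 : Filter.Tendsto (fun N : ℕ => ((1 / Real.sqrt N : ℝ) : ℂ)) Filter.atTop (nhds 0) := by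
    exact_mod_cast (Complex.continuous_ofReal.tendsto 0).comp aux_sqrt_inv
  have h := (h1.mul (aux_B2 u)).add_const ((u : ℂ) * Complex.I)
  rw [zero_mul, zero_add] at h
  refine h.congr' ?_
  filter_upwards [Filter.eventually_ge_atTop 1] with N hN
  have hN0 : (0 : ℝ) < N := by exact_mod_cast hN
  have hs : 0 < Real.sqrt N := Real.sqrt_pos.2 hN0
  have hs' : ((Real.sqrt N : ℝ) : ℂ) ≠ 0 := by exact_mod_cast hs.ne'
  have hss : ((Real.sqrt N : ℝ) : ℂ) ^ 2 = N := by exact_mod_cast Real.sq_sqrt hN0.le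
  rw [← hss]
  push_cast
  field_simp
  ring

lemma aux_e0 (u : ℝ) : Filter.Tendsto (fun N : ℕ =>
    Complex.exp (((u / Real.sqrt N : ℝ) : ℂ) * Complex.I)) Filter.atTop (nhds 1) := by
  have h0 : Filter.Tendsto (fun N : ℕ => (u / Real.sqrt N : ℝ)) Filter.atTop (nhds 0) := by
    simpa [div_eq_mul_inv] using aux_sqrt_inv.const_mul u
  have hc : Continuous (fun θ : ℝ => Complex.exp ((θ : ℂ) * Complex.I)) := by fun_prop
  have h := (hc.tendsto 0).comp h0
  rw [Complex.ofReal_zero, zero_mul, Complex.exp_zero] at h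
  exact h

lemma aux_pt (k α : ℕ) (A ρ : ℝ) (h0 : 0 < ρ) (h1 : ρ < 1) (hA : A * ρ = (1 - ρ) ^ 2) (u : ℝ) :
    Filter.Tendsto (fun N : ℕ => auxH k α A ρ N (u / Real.sqrt N)) Filter.atTop
      (nhds (((Real.exp (-(1 / 2 + ρ / (1 - ρ)) * u ^ 2) * (1 / (1 - ρ) ^ (α + 1)) : ℝ)) : ℂ)) := by
  have hρ : (1 - ρ : ℂ) ≠ 0 := by exact_mod_cast (sub_pos.2 h1).ne'
  have hρ0 : (ρ : ℂ) ≠ 0 := by exact_mod_cast h0.ne'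
  have hA' : (A : ℂ) * ρ = (1 - ρ) ^ 2 := by exact_mod_cast hA
  set q : ℂ := ρ / (1 - ρ) with hq
  have he0 := aux_e0 u
  have hE : Filter.Tendsto (fun N : ℕ => (N : ℂ) *
      (Complex.exp (((u / Real.sqrt N : ℝ) : ℂ) * Complex.I) - 1 - ((u / Real.sqrt N : ℝ) : ℂ) * Complex.I)
      + q * (((Real.sqrt N : ℝ) : ℂ) *
    (Complex.exp (((u / Real.sqrt N : ℝ) : ℂ) * Complex.I) - 1)) ^ 2 /
      (1 - q * (Complex.exp (((u / Real.sqrt N : ℝ) : ℂ) * Complex.I) - 1))) Filter.atTop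
      (nhds (-(u : ℂ) ^ 2 / 2 + q * ((u : ℂ) * Complex.I) ^ 2 / (1 - q * (1 - 1)))) := by
    refine (aux_B2 u).add ((((aux_B1 u).pow 2).const_mul q).div (((he0.sub_const 1).const_mul q).const_sub 1) ?_)
    simp
  have hT : Filter.Tendsto (fun N : ℕ => 1 / (1 - (ρ : ℂ) *
      Complex.exp (((u / Real.sqrt N : ℝ) : ℂ) * Complex.I)) ^ (α + 1)) Filter.atTop
      (nhds (1 / (1 - (ρ : ℂ) * 1) ^ (α + 1))) := by
    refine Filter.Tendsto.div tendsto_const_nhds (((he0.const_mul (ρ : ℂ)).const_sub 1).pow (α + 1)) ?_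
    rw [mul_one]; exact pow_ne_zero _ hρ
  have hK := he0.pow k
  have hall := ((hE.cexp).mul hT).mul hK
  have hlim : Complex.exp (-(u : ℂ) ^ 2 / 2 + q * ((u : ℂ) * Complex.I) ^ 2 / (1 - q * (1 - 1))) *
      (1 / (1 - (ρ : ℂ) * 1) ^ (α + 1)) * 1 ^ k =
      (((Real.exp (-(1 / 2 + ρ / (1 - ρ)) * u ^ 2) * (1 / (1 - ρ) ^ (α + 1)) : ℝ)) : ℂ) := by
    push_cast
    rw [mul_pow, Complex.I_sq, one_pow, mul_one, mul_one]
    congr 2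
    rw [hq]; simp; ring
  rw [hlim] at hall
  refine hall.congr fun N => ?_
  unfold auxH
  have hss : ((Real.sqrt N : ℝ) : ℂ) ^ 2 = N := by exact_mod_cast Real.sq_sqrt (Nat.cast_nonneg N)
  have hne : 1 - (ρ : ℂ) * Complex.exp (((u / Real.sqrt N : ℝ) : ℂ) * Complex.I) ≠ 0 := by
    intro h
    have h2 : (ρ : ℂ) * Complex.exp (((u / Real.sqrt N : ℝ) : ℂ) * Complex.I) = 1 := by
      linear_combination -h
    have h3 := congrArg norm h2
    rw [norm_mul, Complex.norm_exp_ofReal_mul_I] at h3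
    simp [abs_of_pos h0] at h3
    linarith
  set θ : ℂ := ((u / Real.sqrt N : ℝ) : ℂ)
  set w := Complex.exp (θ * Complex.I) with hw
  have hk : w ^ k = Complex.exp (k * (θ * Complex.I)) := by rw [hw, ← Complex.exp_nat_mul]
  have hden : 1 - q * (w - 1) = (1 - ρ * w) / (1 - ρ) := by
    rw [hq]; field_simp; ring
  have hid : (N : ℂ) * (A * (ρ * w / (1 - ρ * w) - ρ / (1 - ρ))) =
      N * (w - 1) + q * (((Real.sqrt N : ℝ) : ℂ) * (w - 1)) ^ 2 / (1 - q * (w - 1)) := by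
    rw [hden, mul_pow, hss, hq]
    have hAe : (A : ℂ) = (1 - ρ) ^ 2 / ρ := by field_simp; exact hA'
    rw [hAe]
    field_simp
    ring
  have hexp : Complex.exp ((N : ℂ) * (w - 1 - θ * Complex.I) +
      q * (((Real.sqrt N : ℝ) : ℂ) * (w - 1)) ^ 2 / (1 - q * (w - 1))) * Complex.exp (k * (θ * Complex.I)) =
      Complex.exp (N * (A * (ρ * w / (1 - ρ * w) - ρ / (1 - ρ)))) *
        Complex.exp (-((N - k) * θ * Complex.I)) := by
    rw [← Complex.exp_add, ← Complex.exp_add, hid]; congr 1; ring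
  rw [hk]
  linear_combination (1 / (1 - ρ * w) ^ (α + 1)) * hexp

lemma aux_bound (k α : ℕ) (A ρ : ℝ) (h0 : 0 < ρ) (h1 : ρ < 1) (hA : 0 ≤ A) (N : ℕ) (θ : ℝ)
    (hθ : |θ| ≤ Real.pi) :
    ‖auxH k α A ρ N θ‖ ≤ Real.exp (-(N * (A * (ρ / ((1 - ρ) * (1 + ρ)) * (2 / Real.pi ^ 2 * θ ^ 2))))) *
      (1 / (1 - ρ) ^ (α + 1)) := by
  unfold auxH
  have hρ1 : 0 < 1 - ρ := sub_pos.2 h1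
  have hn : ‖Complex.exp (-(((N : ℂ) - k) * θ * Complex.I))‖ = 1 := by
    have := Complex.norm_exp_ofReal_mul_I (-((N - k) * θ))
    push_cast at this
    rw [← this]; congr 2; ring
  rw [norm_mul, norm_mul, hn, mul_one, Complex.norm_exp]
  have hw : ‖(ρ : ℂ) * Complex.exp (θ * Complex.I)‖ = ρ := by
    rw [norm_mul, Complex.norm_exp_ofReal_mul_I]; simp [abs_of_pos h0]
  have hge : 1 - ρ ≤ ‖1 - (ρ : ℂ) * Complex.exp (θ * Complex.I)‖ := by
    have := norm_sub_norm_le (1 : ℂ) ((ρ : ℂ) * Complex.exp (θ * Complex.I))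
    rw [hw] at this; simpa using this
  have hc1 : Real.cos θ ≤ 1 := Real.cos_le_one θ
  have hc2 : -1 ≤ Real.cos θ := Real.neg_one_le_cos θ
  have hd : 0 < 1 - 2 * ρ * Real.cos θ + ρ ^ 2 := by nlinarith
  gcongr
  · have hre : ((N : ℂ) * (A * (ρ * Complex.exp (θ * Complex.I) / (1 - ρ * Complex.exp (θ * Complex.I))
        - ρ / (1 - ρ)))).re =
        -(N * (A * (ρ * (1 + ρ) * (1 - Real.cos θ) / ((1 - ρ) * (1 - 2 * ρ * Real.cos θ + ρ ^ 2))))) := by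
      have e1 : ((N : ℂ) * (A * (ρ * Complex.exp (θ * Complex.I) / (1 - ρ * Complex.exp (θ * Complex.I))
        - ρ / (1 - ρ)))) = ((N * A : ℝ) : ℂ) *
          (ρ * Complex.exp (θ * Complex.I) / (1 - ρ * Complex.exp (θ * Complex.I)) - ((ρ / (1 - ρ) : ℝ) : ℂ)) := by
        push_cast; ring
      have hdd : Complex.normSq (1 - ρ * Complex.exp (θ * Complex.I)) = 1 - 2 * ρ * Real.cos θ + ρ ^ 2 := by
        rw [Complex.normSq_apply]
        simp only [Complex.sub_re, Complex.sub_im, Complex.re_ofReal_mul, Complex.im_ofReal_mul,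
          Complex.exp_ofReal_mul_I_re, Complex.exp_ofReal_mul_I_im, Complex.one_re, Complex.one_im]
        linear_combination ρ ^ 2 * Real.sin_sq_add_cos_sq θ
      rw [e1, Complex.re_ofReal_mul, Complex.sub_re, Complex.ofReal_re, Complex.div_re, hdd]
      simp only [Complex.sub_re, Complex.sub_im, Complex.re_ofReal_mul, Complex.im_ofReal_mul,
          Complex.exp_ofReal_mul_I_re, Complex.exp_ofReal_mul_I_im, Complex.one_re, Complex.one_im]
      rw [mul_assoc, ← mul_neg, ← mul_neg]
      congr 2
      have hs : Real.sin θ ^ 2 = 1 - Real.cos θ ^ 2 := by linarith [Real.sin_sq_add_cos_sq θ]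
      have hd' : 1 - ρ * Real.cos θ * 2 + ρ ^ 2 ≠ 0 := by
        intro h; linarith
      field_simp
      linear_combination (-ρ * (1 - ρ)) * hs
    rw [hre]
    have hcq : Real.cos θ ≤ 1 - 2 / Real.pi ^ 2 * θ ^ 2 := Real.cos_le_one_sub_mul_cos_sq hθ
    gcongr
    calc ρ / ((1 - ρ) * (1 + ρ)) * (2 / Real.pi ^ 2 * θ ^ 2)
        ≤ ρ / ((1 - ρ) * (1 + ρ)) * (1 - Real.cos θ) := by gcongr; linarith
      _ = ρ * (1 + ρ) * (1 - Real.cos θ) / ((1 - ρ) * (1 + ρ) ^ 2) := by field_simp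
      _ ≤ _ := by
        have := sub_nonneg.2 hc1
        gcongr
        nlinarith
  · rw [norm_div, norm_pow, norm_one]
    gcongr

lemma aux_int (k α : ℕ) (A ρ : ℝ) (h0 : 0 < ρ) (h1 : ρ < 1) (hA : A * ρ = (1 - ρ) ^ 2) :
    Filter.Tendsto (fun N : ℕ => ((Real.sqrt N : ℝ) : ℂ) * ∫ θ in (-Real.pi)..Real.pi, auxH k α A ρ N θ)
      Filter.atTop (nhds ((Real.sqrt (Real.pi / (1 / 2 + ρ / (1 - ρ))) * (1 / (1 - ρ) ^ (α + 1)) : ℝ) : ℂ)) := by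
  have hρ1 : 0 < 1 - ρ := sub_pos.2 h1
  have hApos : 0 < A := by
    have : 0 < A * ρ := by rw [hA]; positivity
    exact pos_of_mul_pos_left this h0.le
  set c : ℝ := A * (ρ / ((1 - ρ) * (1 + ρ)) * (2 / Real.pi ^ 2)) with hc
  have hcpos : 0 < c := by have := Real.pi_pos; positivity
  have hcont : ∀ N : ℕ, Continuous (fun θ : ℝ => auxH k α A ρ N θ) := by
    intro N
    have hne : ∀ θ : ℝ, 1 - (ρ : ℂ) * Complex.exp (θ * Complex.I) ≠ 0 := by
      intro θ h
      have h2 : (ρ : ℂ) * Complex.exp (θ * Complex.I) = 1 := by linear_combination -h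
      have h3 := congrArg norm h2
      rw [norm_mul, Complex.norm_exp_ofReal_mul_I] at h3
      simp [abs_of_pos h0] at h3
      linarith
    unfold auxH
    have hne2 : ∀ θ : ℝ, (1 - (ρ : ℂ) * Complex.exp (θ * Complex.I)) ^ (α + 1) ≠ 0 :=
      fun θ => pow_ne_zero _ (hne θ)
    fun_prop (disch := first | exact hne2 _ | exact hne _)
  have hD := MeasureTheory.tendsto_integral_of_dominated_convergence (μ := MeasureTheory.volume)
    (F := fun (N : ℕ) (u : ℝ) => (Set.Ioc (-Real.pi * Real.sqrt N) (Real.pi * Real.sqrt N)).indicator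
      (fun u => auxH k α A ρ N (u / Real.sqrt N)) u)
    (f := fun u : ℝ => (((Real.exp (-(1 / 2 + ρ / (1 - ρ)) * u ^ 2) * (1 / (1 - ρ) ^ (α + 1)) : ℝ)) : ℂ))
    (fun u => Real.exp (-c * u ^ 2) * (1 / (1 - ρ) ^ (α + 1))) ?_ ?_ ?_ ?_
  · rw [integral_complex_ofReal, MeasureTheory.integral_mul_const, integral_gaussian] at hD
    refine hD.congr' ?_
    filter_upwards [Filter.eventually_ge_atTop 1] with N hN
    have hN0 : (0 : ℝ) < N := by exact_mod_cast hN
    have hs : 0 < Real.sqrt N := Real.sqrt_pos.2 hN0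
    rw [MeasureTheory.integral_indicator measurableSet_Ioc, ← intervalIntegral.integral_of_le,
      intervalIntegral.integral_comp_div (fun θ => auxH k α A ρ N θ) hs.ne', mul_div_cancel_right₀ _ hs.ne',
      mul_div_cancel_right₀ _ hs.ne', Complex.real_smul]
    nlinarith [Real.pi_pos]
  · intro N
    exact (((hcont N).comp (continuous_id.div_const _)).aestronglyMeasurable).indicator measurableSet_Ioc
  · exact (integrable_exp_neg_mul_sq hcpos).mul_const _
  · intro N
    refine Filter.Eventually.of_forall fun u => ?_
    by_cases hu : u ∈ Set.Ioc (-Real.pi * Real.sqrt N) (Real.pi * Real.sqrt N)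
    · simp only [Set.indicator_of_mem hu]
      have hs : 0 < Real.sqrt N := by
        obtain ⟨ha, hb⟩ := hu
        by_contra hcon
        have : Real.sqrt N = 0 := le_antisymm (not_lt.1 hcon) (Real.sqrt_nonneg _)
        rw [this] at ha hb
        linarith
      have hss : Real.sqrt N ^ 2 = N := Real.sq_sqrt (Nat.cast_nonneg N)
      have hab : |u / Real.sqrt N| ≤ Real.pi := by
        rw [abs_le, le_div_iff₀ hs, div_le_iff₀ hs]
        exact ⟨hu.1.le, hu.2⟩
      refine (aux_bound k α A ρ h0 h1 hApos.le N _ hab).trans_eq ?_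
      congr 2
      rw [div_pow, hss, hc]
      have : (N : ℝ) ≠ 0 := by rw [← hss]; positivity
      field_simp
    · simp only [Set.indicator_of_notMem hu, norm_zero]
      positivity
  · refine Filter.Eventually.of_forall fun u => ?_
    refine (aux_pt k α A ρ h0 h1 hA u).congr' ?_
    have ht : Filter.Tendsto (fun N : ℕ => Real.pi * Real.sqrt N) Filter.atTop Filter.atTop :=
      (Real.tendsto_sqrt_atTop.comp tendsto_natCast_atTop_atTop).const_mul_atTop Real.pi_pos
    filter_upwards [ht.eventually_gt_atTop |u|] with N hN
    rw [Set.indicator_of_mem]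
    obtain ⟨ha, hb⟩ := abs_lt.1 hN
    exact ⟨by linarith, hb.le⟩

/-- For fixed integers `k, α ≥ 0` and real `Y > 0`, with
`r_* = (√(Y²+4) − Y)/2`:
`lim_{N→∞} √(2πN)·Y^{α+1/2}·(Y²+4)^{1/4}·r_*^{2(N−k)+α+1}·e^{−NY·r_*}·L_{N−k}^{(α)}(−NY²) = 1`. -/
theorem laguerre_asymptotics_large_argument (k α : ℕ) (Y : ℝ) (hY : 0 < Y) :
    Filter.Tendsto
      (fun N : ℕ =>
        Real.sqrt (2 * Real.pi * N) * Y ^ ((α : ℝ) + 1 / 2) *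
          (Y ^ 2 + 4) ^ ((1 : ℝ) / 4) * rstar Y ^ (2 * (N - k) + α + 1) *
          Real.exp (-(N : ℝ) * Y * rstar Y) * Lag (N - k) α (-(N : ℝ) * Y ^ 2))
      Filter.atTop (nhds 1) := by
  set S := Real.sqrt (Y ^ 2 + 4) with hS
  have hS2 : S ^ 2 = Y ^ 2 + 4 := Real.sq_sqrt (by positivity)
  have hSY : Y < S := by
    rw [hS]; apply Real.lt_sqrt_of_sq_lt; linarith
  have hSpos : 0 < S := hY.trans hSY
  set r := rstar Y with hr
  have hrS : r = (S - Y) / 2 := by rw [hr, rstar]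
  have hrpos : 0 < r := by rw [hrS]; linarith
  have hq : 1 - r ^ 2 = Y * r := by rw [hrS]; nlinarith
  set ρ := r ^ 2 with hρ
  have h0 : 0 < ρ := by positivity
  have h1 : ρ < 1 := by
    have : 0 < Y * r := by positivity
    linarith
  have hA : Y ^ 2 * ρ = (1 - ρ) ^ 2 := by rw [hq, hρ]; ring
  have hlim := (aux_int k α (Y ^ 2) ρ h0 h1 hA)
  -- the constant
  set C : ℝ := Real.sqrt (2 * Real.pi) * Y ^ ((α : ℝ) + 1 / 2) * (Y ^ 2 + 4) ^ ((1 : ℝ) / 4) *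
    r ^ (α + 1) / (2 * Real.pi) with hC
  have hpi := Real.pi_pos
  have hCL : C * (Real.sqrt (Real.pi / (1 / 2 + ρ / (1 - ρ))) * (1 / (1 - ρ) ^ (α + 1))) = 1 := by
    have hb : 1 / 2 + ρ / (1 - ρ) = S / (2 * Y) := by
      rw [hq, hρ]
      have : S = 2 * r + Y := by rw [hrS]; ring
      rw [this]; field_simp; ring
    have hY4 : (Y ^ 2 + 4) ^ ((1 : ℝ) / 4) = Real.sqrt S := by
      rw [hS, Real.sqrt_eq_rpow, Real.sqrt_eq_rpow, ← Real.rpow_mul (by positivity)]; norm_num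
    have hYp : Y ^ ((α : ℝ) + 1 / 2) = Y ^ α * Real.sqrt Y := by
      rw [Real.rpow_add hY, Real.rpow_natCast, Real.sqrt_eq_rpow]
    have hsq : Real.sqrt (Real.pi / (S / (2 * Y))) = Real.sqrt (2 * Real.pi) * Real.sqrt Y / Real.sqrt S := by
      rw [← Real.sqrt_mul (by positivity), ← Real.sqrt_div (by positivity)]
      congr 1; field_simp
    rw [hC, hb, hsq, hq, hY4, hYp]
    have e1 : Real.sqrt (2 * Real.pi) ^ 2 = 2 * Real.pi := Real.sq_sqrt (by positivity)
    have e2 : Real.sqrt Y ^ 2 = Y := Real.sq_sqrt hY.le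
    have e3 : 0 < Real.sqrt S := Real.sqrt_pos.2 hSpos
    rw [mul_pow]
    have : Real.sqrt (2 * Real.pi) * (Y ^ α * Real.sqrt Y) * Real.sqrt S * r ^ (α + 1) / (2 * Real.pi) *
      (Real.sqrt (2 * Real.pi) * Real.sqrt Y / Real.sqrt S * (1 / (Y ^ (α + 1) * r ^ (α + 1)))) =
      (Real.sqrt (2 * Real.pi) ^ 2 / (2 * Real.pi)) * (Real.sqrt Y ^ 2 / Y) := by
      rw [pow_succ Y α]
      field_simp
    rw [this, e1, e2]
    field_simp
  have hfin := hlim.const_mul (C : ℂ)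
  rw [← Complex.ofReal_mul, hCL] at hfin
  have hre := (Complex.continuous_re.tendsto _).comp hfin
  rw [Complex.ofReal_re] at hre
  refine hre.congr' ?_
  filter_upwards [Filter.eventually_ge_atTop k] with N hN
  have hco := aux_coeff (N - k) α (N * Y ^ 2) ρ (by positivity) h0.le h1
  have hint : ∫ θ in (-Real.pi)..Real.pi, auxH k α (Y ^ 2) ρ N θ =
      ((Real.exp (-(N : ℝ) * Y * r) * (2 * Real.pi * ρ ^ (N - k) * Lag (N - k) α (-(N * Y ^ 2))) : ℝ) : ℂ) := by
    rw [Complex.ofReal_mul, ← hco, ← intervalIntegral.integral_const_mul]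
    congr 1; funext θ
    unfold auxH
    have hx : (-(N : ℂ) * Y * r) = -(N * (((Y ^ 2 : ℝ) : ℂ) * (ρ / (1 - ρ)))) := by
      have : -(N : ℝ) * Y * r = -(N * (Y ^ 2 * (ρ / (1 - ρ)))) := by
        rw [hq, hρ]; field_simp
      exact_mod_cast this
    rw [mul_sub, mul_sub, sub_eq_add_neg, Complex.exp_add, ← hx]
    push_cast [Nat.cast_sub hN]
    rw [mul_assoc (N : ℂ)]
    ring
  simp only [Function.comp]
  rw [hint, ← Complex.ofReal_mul, ← Complex.ofReal_mul, Complex.ofReal_re, hC,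
    Real.sqrt_mul (by positivity) (N : ℝ), neg_mul (N : ℝ) (Y ^ 2)]
  have : r ^ (2 * (N - k) + α + 1) = ρ ^ (N - k) * r ^ (α + 1) := by
    rw [hρ, ← pow_mul, ← pow_add]; congr 1
  rw [this]
  field_simp
end

section
/- Fix an integer k ≥ 0, an integer α ≥ 0, and a real y > 0. Then lim_{N→∞} (y/N)^α · L_{N−k}^{(α)}(−y²/N) = I_α(2y). -/
/-- The modified Bessel function of the first kind of integer order `α`:
`I_α(x) = Σ_{k=0}^∞ (x/2)^{2k+α}/(k!·(k+α)!)`. -/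
noncomputable def besselI (α : ℕ) (x : ℝ) : ℝ :=
  ∑' k : ℕ, (x / 2) ^ (2 * k + α) / ((Nat.factorial k : ℝ) * (Nat.factorial (k + α) : ℝ))

theorem lag_aux_ratio (k α m : ℕ) :
    Filter.Tendsto (fun N : ℕ => ((N - k + α - m : ℕ) : ℝ) / (N : ℝ)) Filter.atTop (nhds 1) := by
  have h : Filter.Tendsto (fun N : ℕ => (1 : ℝ) + ((α : ℝ) - k - m) / (N : ℝ))
      Filter.atTop (nhds (1 + 0)) :=
    tendsto_const_nhds.add (tendsto_const_div_atTop_nhds_zero_nat _)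
  rw [add_zero] at h
  refine h.congr' ?_
  filter_upwards [Filter.eventually_ge_atTop (k + m + 1)] with N hN
  have h0 : (N : ℝ) ≠ 0 := by
    have : N ≠ 0 := by omega
    exact_mod_cast this
  rw [Nat.cast_sub (by omega), Nat.cast_add, Nat.cast_sub (by omega)]
  field_simp
  ring

theorem lag_aux_desc (k α m : ℕ) :
    Filter.Tendsto (fun N : ℕ => ((N - k + α).descFactorial m : ℝ) / (N : ℝ) ^ m)
      Filter.atTop (nhds 1) := by
  induction m with
  | zero => simp
  | succ m ih =>
    have h := (lag_aux_ratio k α m).mul ih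
    rw [one_mul] at h
    refine h.congr fun N => ?_
    rw [Nat.descFactorial_succ, Nat.cast_mul, pow_succ', div_mul_div_comm]

theorem lag_aux_choose (n m : ℕ) :
    (n.choose m : ℝ) = (n.descFactorial m : ℝ) / (Nat.factorial m : ℝ) := by
  rw [Nat.descFactorial_eq_factorial_mul_choose, Nat.cast_mul]
  field_simp

theorem lag_aux_sum (n α : ℕ) (y M : ℝ) :
    (y / M) ^ α * Lag n α (-y ^ 2 / M) =
      ∑' j : ℕ, y ^ (2 * j + α) / ((Nat.factorial j : ℝ) * (Nat.factorial (j + α) : ℝ)) *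
        (((n + α).descFactorial (j + α) : ℝ) / M ^ (j + α)) := by
  rw [tsum_eq_sum (s := Finset.range (n + 1)), Lag, Finset.mul_sum]
  · refine Finset.sum_congr rfl fun j hj => ?_
    have hj' : j ≤ n := by
      have := Finset.mem_range.mp hj
      omega
    have e : (n + α).choose (n - j) = (n + α).choose (j + α) :=
      Nat.choose_symm_of_eq_add (by omega)
    have e2 : (-1 : ℝ) ^ j * (-y ^ 2 / M) ^ j = y ^ (2 * j) / M ^ j := by
      rw [← mul_pow, pow_mul, ← div_pow]
      congr 1
      ring
    rw [e, lag_aux_choose]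
    calc _ = (y / M) ^ α * (((n + α).descFactorial (j + α) : ℝ) / (Nat.factorial (j + α) : ℝ)) *
          ((-1 : ℝ) ^ j * (-y ^ 2 / M) ^ j) / (Nat.factorial j : ℝ) := by ring
      _ = _ := by
        rw [e2, div_pow, pow_add, pow_add]
        simp only [div_eq_mul_inv, mul_inv]
        ring
  · intro j hj
    have : n + α < j + α := by
      simp only [Finset.mem_range] at hj
      omega
    rw [Nat.descFactorial_of_lt this]
    simp

/-- For fixed integers `k, α ≥ 0` and real `y > 0`:
`lim_{N→∞} (y/N)^α · L_{N−k}^{(α)}(−y²/N) = I_α(2y)`. -/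
theorem laguerre_bessel_limit (k α : ℕ) (y : ℝ) (hy : 0 < y) :
    Filter.Tendsto
      (fun N : ℕ => (y / (N : ℝ)) ^ α * Lag (N - k) α (-y ^ 2 / (N : ℝ)))
      Filter.atTop (nhds (besselI α (2 * y))) := by
  simp only [lag_aux_sum, besselI]
  refine tendsto_tsum_of_dominated_convergence
    (bound := fun j : ℕ => y ^ α * (1 + α : ℝ) ^ α *
      ((y ^ 2 * (1 + α : ℝ)) ^ j / (Nat.factorial j : ℝ))) ?_ ?_ ?_
  · exact (Real.summable_pow_div_factorial _).mul_left _
  · intro j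
    have h := (lag_aux_desc k α (j + α)).const_mul
      (y ^ (2 * j + α) / ((Nat.factorial j : ℝ) * (Nat.factorial (j + α) : ℝ)))
    rw [mul_one] at h
    rw [mul_div_cancel_left₀ y (two_ne_zero)]
    exact h
  · filter_upwards [Filter.eventually_ge_atTop 1] with N hN j
    have hN0 : (0 : ℝ) < N := by exact_mod_cast hN
    rw [Real.norm_of_nonneg (by positivity)]
    have h1 : ((N - k + α).descFactorial (j + α) : ℝ) / (N : ℝ) ^ (j + α) ≤
        (1 + α : ℝ) ^ (j + α) := by
      rw [div_le_iff₀ (by positivity), ← mul_pow]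
      have a1 : (N - k + α).descFactorial (j + α) ≤ (N - k + α) ^ (j + α) :=
        Nat.descFactorial_le_pow _ _
      have a2 : N - k + α ≤ (1 + α) * N := by
        have : α * 1 ≤ α * N := Nat.mul_le_mul_left _ hN
        rw [add_mul]
        omega
      exact_mod_cast a1.trans (Nat.pow_le_pow_left a2 _)
    have h2 : y ^ (2 * j + α) / ((Nat.factorial j : ℝ) * (Nat.factorial (j + α) : ℝ)) ≤
        y ^ (2 * j + α) / (Nat.factorial j : ℝ) := by
      have : (1 : ℝ) ≤ (Nat.factorial (j + α) : ℝ) := by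
        exact_mod_cast Nat.factorial_pos _
      apply div_le_div_of_nonneg_left (by positivity) (by positivity)
      exact le_mul_of_one_le_right (by positivity) this
    calc _ ≤ y ^ (2 * j + α) / (Nat.factorial j : ℝ) * (1 + α : ℝ) ^ (j + α) := by gcongr
      _ = _ := by
        rw [mul_pow, pow_add, pow_add, pow_mul]
        ring
end

section
/- For every real y: (1/(4π)) · ∫_{−2}^{2} ( e^{y·√(4−X²)} − e^{−y·√(4−X²)} ) dX = I_1(2y). -/
open MeasureTheory intervalIntegral

/-- The modified Bessel function of the first kind of order 1:
`I_1(x) = Σ_{k=0}^∞ (x/2)^{2k+1}/(k!·(k+1)!)`. -/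
noncomputable def besselI1 (x : ℝ) : ℝ :=
  ∑' k : ℕ, (x / 2) ^ (2 * k + 1) / ((Nat.factorial k : ℝ) * (Nat.factorial (k + 1) : ℝ))

lemma aux_prod (n : ℕ) :
    ∏ i ∈ Finset.range n, (2 * (i : ℝ) + 1) / (2 * i + 2)
      = (Nat.factorial (2 * n) : ℝ) / (4 ^ n * (Nat.factorial n : ℝ) ^ 2) := by
  induction n with
  | zero => simp
  | succ k ih =>
    rw [Finset.prod_range_succ, ih, show 2 * (k + 1) = 2 * k + 1 + 1 by ring]
    simp only [Nat.factorial_succ]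
    push_cast
    have : (Nat.factorial k : ℝ) ≠ 0 := by positivity
    have : (k : ℝ) + 1 ≠ 0 := by positivity
    field_simp
    ring

lemma aux_subst (y : ℝ) :
    (∫ X in (-2 : ℝ)..2,
        (Real.exp (y * Real.sqrt (4 - X ^ 2)) - Real.exp (-y * Real.sqrt (4 - X ^ 2))))
      = ∫ t in (0 : ℝ)..Real.pi, 4 * Real.sin t * Real.sinh (2 * y * Real.sin t) := by
  have h := intervalIntegral.integral_comp_mul_deriv' (a := 0) (b := Real.pi)
    (f := fun t => -2 * Real.cos t) (f' := fun t => 2 * Real.sin t)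
    (g := fun X => Real.exp (y * Real.sqrt (4 - X ^ 2)) - Real.exp (-y * Real.sqrt (4 - X ^ 2)))
    (fun x _ => by
      have := (Real.hasDerivAt_cos x).const_mul (-2)
      have e : 2 * Real.sin x = -2 * -Real.sin x := by ring
      simp only [e]
      exact this)
    (by fun_prop) (by fun_prop)
  simp only [Real.cos_zero, Real.cos_pi] at h
  norm_num at h
  norm_num
  rw [← h]
  apply intervalIntegral.integral_congr
  intro t ht
  rw [Set.uIcc_of_le Real.pi_pos.le] at ht
  have hs : 0 ≤ Real.sin t := Real.sin_nonneg_of_mem_Icc ht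
  have hq : Real.sqrt (4 - (-2 * Real.cos t) ^ 2) = 2 * Real.sin t := by
    rw [show 4 - (-2 * Real.cos t) ^ 2 = (2 * Real.sin t) ^ 2 by
      nlinarith [Real.sin_sq_add_cos_sq t]]
    exact Real.sqrt_sq (by positivity)
  simp only [neg_mul, even_two, Even.neg_pow] at hq
  simp only [hq, Real.sinh_eq]
  rw [show y * (2 * Real.sin t) = 2 * y * Real.sin t by ring]
  ring

lemma aux_hasSum_s17 (y : ℝ) :
    HasSum (fun k : ℕ => ∫ t in (0 : ℝ)..Real.pi,
        4 * Real.sin t * ((2 * y * Real.sin t) ^ (2 * k + 1) / (Nat.factorial (2 * k + 1) : ℝ)))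
      (∫ t in (0 : ℝ)..Real.pi, 4 * Real.sin t * Real.sinh (2 * y * Real.sin t)) := by
  apply intervalIntegral.hasSum_integral_of_dominated_convergence
    (fun k _ => 4 * ((2 * |y|) ^ (2 * k + 1) / (Nat.factorial (2 * k + 1) : ℝ)))
  · intro n
    exact Continuous.aestronglyMeasurable (by fun_prop)
  · intro n
    refine Filter.Eventually.of_forall fun t _ => ?_
    have h1 := Real.abs_sin_le_one t
    simp only [norm_mul, norm_div, norm_pow, Real.norm_eq_abs, Nat.abs_cast, Nat.abs_ofNat]
    have h2 : 2 * |y| * |Real.sin t| ≤ 2 * |y| := mul_le_of_le_one_right (by positivity) h1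
    have h3 : 4 * |Real.sin t| ≤ 4 := by linarith
    gcongr
  · refine Filter.Eventually.of_forall fun t _ => ?_
    exact ((Real.hasSum_sinh (2 * |y|)).summable).mul_left 4
  · exact intervalIntegrable_const
  · refine Filter.Eventually.of_forall fun t _ => ?_
    exact (Real.hasSum_sinh _).mul_left _

lemma aux_term (y : ℝ) (k : ℕ) :
    (1 / (4 * Real.pi)) * (∫ t in (0 : ℝ)..Real.pi,
        4 * Real.sin t * ((2 * y * Real.sin t) ^ (2 * k + 1) / (Nat.factorial (2 * k + 1) : ℝ)))
      = (2 * y / 2) ^ (2 * k + 1) / ((Nat.factorial k : ℝ) * (Nat.factorial (k + 1) : ℝ)) := by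
  have h : ∀ t : ℝ,
      4 * Real.sin t * ((2 * y * Real.sin t) ^ (2 * k + 1) / (Nat.factorial (2 * k + 1) : ℝ))
      = (4 * (2 * y) ^ (2 * k + 1) / (Nat.factorial (2 * k + 1) : ℝ))
        * Real.sin t ^ (2 * (k + 1)) := by
    intro t
    rw [mul_pow]
    ring
  simp only [h]
  rw [intervalIntegral.integral_const_mul, integral_sin_pow_even, aux_prod,
    show 2 * (k + 1) = (2 * k + 1) + 1 by ring, Nat.factorial_succ (2 * k + 1),
    Nat.factorial_succ k, mul_div_cancel_left₀ y two_ne_zero, mul_pow,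
    show (4 : ℝ) ^ (k + 1) = 2 * 2 ^ (2 * k + 1) by
      rw [show (4 : ℝ) = 2 ^ 2 by norm_num, ← pow_mul]; ring]
  push_cast
  have := Real.pi_ne_zero
  have : (Nat.factorial k : ℝ) ≠ 0 := by positivity
  have : (Nat.factorial (2 * k + 1) : ℝ) ≠ 0 := by positivity
  have : (k : ℝ) + 1 ≠ 0 := by positivity
  field_simp
  ring

/-- For every real `y`:
`(1/(4π)) ∫_{−2}^{2} (e^{y√(4−X²)} − e^{−y√(4−X²)}) dX = I_1(2y)`. -/
theorem semicircle_integral_besselI1 (y : ℝ) :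
    (1 / (4 * Real.pi)) *
      (∫ X in (-2 : ℝ)..2,
        (Real.exp (y * Real.sqrt (4 - X ^ 2)) - Real.exp (-y * Real.sqrt (4 - X ^ 2))))
      = besselI1 (2 * y) := by
  rw [aux_subst]
  have h := (aux_hasSum_s17 y).mul_left (1 / (4 * Real.pi))
  simp only [aux_term] at h
  exact h.tsum_eq.symm
end

section
/- Let α ≤ 0. Then Q₆(α, m) = −60 − 48α²m + 72αm² − 16α⁴m² + 80α³m³ − 144α²m⁴ + 108αm⁵ − 27m⁶ < 0 for every m > 0, and consequently the limiting density of extreme imaginary parts p̃_α is strictly decreasing on the interval (0, ∞). -/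
/-- The limiting density of extreme imaginary parts
`p̃_α(m) = (1/(2√π)) · (3/(2m) + (3m/2 − α)²) · m^{−3/2} · e^{−m(α−m/2)²}`. -/
noncomputable def ptilde (α m : ℝ) : ℝ :=
  (1 / (2 * Real.sqrt Real.pi)) * (3 / (2 * m) + (3 * m / 2 - α) ^ 2) *
    m ^ (-(3 : ℝ) / 2) * Real.exp (-m * (α - m / 2) ^ 2)

/-- The polynomial `Q₆(α, m)`. -/
def Q6 (α m : ℝ) : ℝ :=
  -60 - 48 * α ^ 2 * m + 72 * α * m ^ 2 - 16 * α ^ 4 * m ^ 2 + 80 * α ^ 3 * m ^ 3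
    - 144 * α ^ 2 * m ^ 4 + 108 * α * m ^ 5 - 27 * m ^ 6

theorem Q6_neg_aux (α : ℝ) (hα : α ≤ 0) (m : ℝ) (hm : 0 < m) : Q6 α m < 0 := by
  obtain ⟨b, rfl⟩ : ∃ b, α = -b := ⟨-α, by ring⟩
  have hb : 0 ≤ b := by linarith
  have e : Q6 (-b) m = -(60 + 48 * b ^ 2 * m + 72 * b * m ^ 2 + 16 * b ^ 4 * m ^ 2
      + 80 * b ^ 3 * m ^ 3 + 144 * b ^ 2 * m ^ 4 + 108 * b * m ^ 5 + 27 * m ^ 6) := by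
    unfold Q6; ring
  rw [e, neg_lt_zero]
  positivity

theorem ptilde_hasDerivAt_aux (α m : ℝ) (hm : 0 < m) :
    HasDerivAt (ptilde α) ((1 / (2 * Real.sqrt Real.pi)) * (Q6 α m / (16 * m ^ 2)) *
      m ^ (-(3 : ℝ) / 2) * Real.exp (-m * (α - m / 2) ^ 2)) m := by
  have hm0 : m ≠ 0 := hm.ne'
  have hid := hasDerivAt_id' m
  have h1 : HasDerivAt (fun m : ℝ => 3 / (2 * m)) _ m :=
    (hasDerivAt_const m (3 : ℝ)).fun_div (hid.const_mul 2) (by positivity)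
  have h2 : HasDerivAt (fun m : ℝ => (3 * m / 2 - α) ^ 2) _ m :=
    (((hid.const_mul 3).div_const 2).sub_const α).fun_pow 2
  have h3 : HasDerivAt (fun m : ℝ => m ^ (-(3 : ℝ) / 2)) _ m :=
    Real.hasDerivAt_rpow_const (Or.inl hm0)
  have h4 : HasDerivAt (fun m : ℝ => -m * (α - m / 2) ^ 2) _ m :=
    hid.fun_neg.fun_mul (((hid.div_const 2).const_sub α).fun_pow 2)
  have h := (((h1.fun_add h2).const_mul (1 / (2 * Real.sqrt Real.pi))).fun_mul h3).fun_mul h4.exp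
  refine HasDerivAt.congr_deriv (f := ptilde α) h ?_
  rw [Real.rpow_sub_one hm0]
  generalize m ^ (-(3 : ℝ) / 2) = R
  generalize Real.exp (-m * (α - m / 2) ^ 2) = E
  generalize 1 / (2 * Real.sqrt Real.pi) = c
  unfold Q6
  field_simp
  norm_num
  ring

/-- For `α ≤ 0`: `Q₆(α, m) < 0` for every `m > 0`, and consequently
`p̃_α` is strictly decreasing on `(0, ∞)`. -/
theorem ptilde_strictAnti_of_nonpos (α : ℝ) (hα : α ≤ 0) :
    (∀ m : ℝ, 0 < m → Q6 α m < 0) ∧ StrictAntiOn (ptilde α) (Set.Ioi 0) := by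
  refine ⟨Q6_neg_aux α hα, ?_⟩
  refine strictAntiOn_of_deriv_neg (convex_Ioi 0)
    (fun m hm => (ptilde_hasDerivAt_aux α m hm).continuousAt.continuousWithinAt) ?_
  intro m hm
  rw [interior_Ioi] at hm
  have hm' : 0 < m := hm
  rw [(ptilde_hasDerivAt_aux α m hm').deriv]
  have hQ : Q6 α m / (16 * m ^ 2) < 0 :=
    div_neg_of_neg_of_pos (Q6_neg_aux α hα m hm') (by positivity)
  have hc : 0 < 1 / (2 * Real.sqrt Real.pi) := by
    have := Real.pi_pos
    positivity
  exact mul_neg_of_neg_of_pos (mul_neg_of_neg_of_pos (mul_neg_of_pos_of_neg hc hQ)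
    (Real.rpow_pos_of_pos hm' _)) (Real.exp_pos _)
end
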